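/- Let p : Fin m → Fin n, and let π₁, π₂ be p-balanced permutations of Fin m with disjoint supports. Then there exist p-cycles σ₁, σ₂, σ₃ of Fin m such that supp(σ₃ ∘ σ₂ ∘ σ₁) = supp(π₂ ∘ π₁) and p ∘ σ₃ ∘ σ₂ ∘ σ₁ = p ∘ π₂ ∘ π₁. -/

import Mathlib

/-- The support of a permutation of `Fin m`, as a set. -/
def psupp {m : ℕ} (π : Equiv.Perm (Fin m)) : Set (Fin m) := {x | π x ≠ x}

/-- A permutation `π` is `p`-balanced if `p` is injective on the support of `π`. -/
def IsBalanced {m n : ℕ} (p : Fin m → Fin n) (π : Equiv.Perm (Fin m)) : Prop :=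
  Set.InjOn p (psupp π)

/-- A `p`-cycle is a `p`-balanced permutation that is the identity or a cycle. -/
def IsPCycle {m n : ℕ} (p : Fin m → Fin n) (π : Equiv.Perm (Fin m)) : Prop :=
  IsBalanced p π ∧ (π = 1 ∨ π.IsCycle)

/-- The size of the fiber of `p` over `i`. -/
def fiberCard {m n : ℕ} (p : Fin m → Fin n) (i : Fin n) : ℕ :=
  (Finset.univ.filter fun x => p x = i).card

open Equiv Equiv.Perm

variable {α : Type*}

/-- The permutation `f` acts on `s` as a single cycle and fixes every point outside `s`. -/
def IsSoleCycleOn (f : Perm α) (s : Set α) : Prop :=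
  f.IsCycleOn s ∧ ∀ x ∉ s, f x = x

theorem IsSoleCycleOn.inv {f : Perm α} {s : Set α} (h : IsSoleCycleOn f s) :
    IsSoleCycleOn f⁻¹ s :=
  ⟨h.1.inv, fun x hx => Perm.inv_eq_iff_eq.2 (h.2 x hx).symm⟩

theorem isSoleCycleOn_one {s : Set α} (hs : s.Subsingleton) : IsSoleCycleOn (1 : Perm α) s :=
  ⟨isCycleOn_one.2 hs, fun _ _ => rfl⟩

theorem IsSoleCycleOn.eq_one_or_isCycle {f : Perm α} {s : Set α} (h : IsSoleCycleOn f s) :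
    f = 1 ∨ f.IsCycle := by
  rcases s.subsingleton_or_nontrivial with hs | hs
  · left
    ext x
    by_cases hx : x ∈ s
    · exact hs (h.1.1.mapsTo hx) hx
    · exact h.2 x hx
  · right
    refine isCycle_iff_exists_isCycleOn.2 ⟨s, hs, h.1, fun x hx => ?_⟩
    by_contra hxs
    exact hx (h.2 x hxs)

/-- A preorder containing all steps of a cycle except the one leaving `z₀`
relates the successor of `z₀` to every point of the cycle. -/
theorem Equiv.Perm.IsCycleOn.rel_of_forall_ne [Finite α] {f : Perm α} {s : Set α}
    (hf : f.IsCycleOn s) {R : α → α → Prop} (hrefl : ∀ a, R a a)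
    (htrans : ∀ a b c, R a b → R b c → R a c) {z₀ : α} (hz₀ : z₀ ∈ s)
    (hR : ∀ z ∈ s, z ≠ z₀ → R z (f z)) {z : α} (hz : z ∈ s) : R (f z₀) z := by
  obtain ⟨n, rfl⟩ := hf.exists_pow_eq' s.toFinite (hf.1.mapsTo hz₀) hz
  clear hz
  induction n with
  | zero => exact hrefl _
  | succ n ih =>
    rw [pow_succ', Perm.mul_apply]
    by_cases h : (f ^ n) (f z₀) = z₀
    · rw [h]; exact hrefl _
    · exact htrans _ _ _ ih (hR _ ((hf.1.mapsTo.perm_pow n) (hf.1.mapsTo hz₀)) h)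

/-- Two disjoint cycles are merged by inserting a transposition between them. -/
theorem IsSoleCycleOn.mul_swap_mul [Finite α] [DecidableEq α] {f g : Perm α} {s t : Set α}
    (hf : IsSoleCycleOn f s) (hg : IsSoleCycleOn g t) (hst : Disjoint s t) {x y : α}
    (hx : x ∈ s) (hy : y ∈ t) : IsSoleCycleOn (f * swap x y * g) (s ∪ t) := by
  have hs : ∀ z ∈ s, z ∉ t := fun z h h' => Set.disjoint_left.1 hst h h'
  set h := f * swap x y * g with hh
  have hfix : ∀ z ∉ s ∪ t, h z = z := by
    intro z hz
    rw [Set.mem_union, not_or] at hz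
    have hzx : z ≠ x := fun e => hz.1 (e ▸ hx)
    have hzy : z ≠ y := fun e => hz.2 (e ▸ hy)
    simp [hh, hg.2 z hz.2, swap_apply_of_ne_of_ne hzx hzy, hf.2 z hz.1]
  have h_s : ∀ z ∈ s, z ≠ x → h z = f z := by
    intro z hz hzx
    have hzy : z ≠ y := fun e => hs z hz (e ▸ hy)
    simp [hh, hg.2 z (hs z hz), swap_apply_of_ne_of_ne hzx hzy]
  have h_x : h x = y := by
    simp [hh, hg.2 x (hs x hx), hf.2 y (fun h => hs y h hy)]
  have h_t : ∀ z ∈ t, g z ≠ y → h z = g z := by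
    intro z hz hzy
    have hgz := hg.1.1.mapsTo hz
    have hzx : g z ≠ x := fun e => hs x hx (e ▸ hgz)
    simp [hh, swap_apply_of_ne_of_ne hzx hzy, hf.2 _ (fun h => hs _ h hgz)]
  have h_y : ∀ z, g z = y → h z = f x := by
    intro z hz
    simp [hh, hz]
  have hmaps : ∀ z ∈ s ∪ t, h z ∈ s ∪ t := by
    rintro z (hz | hz)
    · by_cases hzx : z = x
      · rw [hzx, h_x]; exact Or.inr hy
      · rw [h_s z hz hzx]; exact Or.inl (hf.1.1.mapsTo hz)
    · by_cases hzy : g z = y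
      · rw [h_y z hzy]; exact Or.inl (hf.1.1.mapsTo hx)
      · rw [h_t z hz hzy]; exact Or.inr (hg.1.1.mapsTo hz)
  have hstep : ∀ z, h.SameCycle z (h z) := fun z => sameCycle_apply_right.2 (SameCycle.refl h z)
  have hrefl : ∀ a, h.SameCycle a a := SameCycle.refl h
  have htrans : ∀ a b c, h.SameCycle a b → h.SameCycle b c → h.SameCycle a c :=
    fun _ _ _ => SameCycle.trans
  have key_s : ∀ z ∈ s, h.SameCycle (f x) z := fun z hz =>
    hf.1.rel_of_forall_ne hrefl htrans hx (fun w hw hwx => h_s w hw hwx ▸ hstep w) hz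
  obtain ⟨w, hw, hwy⟩ := hg.1.1.surjOn hy
  have key_t : ∀ z ∈ t, h.SameCycle (f x) z := by
    intro z hz
    have h1 := hg.1.rel_of_forall_ne hrefl htrans hw
      (fun v hv hvw => h_t v hv (fun e => hvw (g.injective (e.trans hwy.symm))) ▸ hstep v) hz
    rw [hwy] at h1
    exact ((key_s x hx).trans (h_x ▸ hstep x)).trans h1
  have key : ∀ z ∈ s ∪ t, h.SameCycle (f x) z := fun z hz => hz.elim (key_s z) (key_t z)
  refine ⟨⟨h.bijOn fun z => ⟨fun hz => ?_, hmaps z⟩,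
    fun a ha b hb => (key a ha).symm.trans (key b hb)⟩, hfix⟩
  by_contra hzn
  exact hzn (hfix z hzn ▸ hz)

variable [Fintype α] [DecidableEq α]

/-- A permutation is the product of a single cycle on its support and a single cycle on any
choice of representatives of its nontrivial cycles. -/
theorem exists_isSoleCycleOn_mul_eq (π : Perm α) :
    ∀ r : Perm α → α, (∀ c ∈ π.cycleFactorsFinset, r c ∈ c.support) →
      ∃ l k : Perm α, IsSoleCycleOn l {x | π x ≠ x} ∧
        IsSoleCycleOn k (r '' π.cycleFactorsFinset) ∧ l * k = π := by
  induction π using cycle_induction_on with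
  | base_one =>
    intro r _
    exact ⟨1, 1, isSoleCycleOn_one (by simp), isSoleCycleOn_one (by simp), rfl⟩
  | base_cycles σ hσ =>
    intro r _
    refine ⟨σ, 1, ⟨hσ.isCycleOn, fun x hx => not_not.1 hx⟩, isSoleCycleOn_one ?_, mul_one σ⟩
    rw [cycleFactorsFinset_eq_singleton_self_iff.2 hσ]
    simp
  | induction_disjoint σ τ hd hσ _ ih =>
    intro r hr
    rw [hd.cycleFactorsFinset_mul_eq_union] at hr ⊢
    rcases τ.cycleFactorsFinset.eq_empty_or_nonempty with he | ⟨c, hc⟩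
    · obtain rfl := cycleFactorsFinset_eq_empty_iff.1 he
      refine ⟨σ, 1, ⟨by simpa using hσ.isCycleOn, fun x hx => by simpa using hx⟩,
        isSoleCycleOn_one ?_, by simp⟩
      rw [cycleFactorsFinset_eq_singleton_self_iff.2 hσ]
      simp
    obtain ⟨l, k, hl, hk, hlk⟩ := ih r fun c hc => hr c (Finset.mem_union_right _ hc)
    have hsupp : {x | (σ * τ) x ≠ x} = {x | σ x ≠ x} ∪ {x | τ x ≠ x} := by
      ext x
      have := congrArg (x ∈ ·) hd.support_mul
      simpa only [Finset.mem_union, mem_support, eq_iff_iff, Set.mem_union, Set.mem_ofPred_eq]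
        using this
    have hσc : σ.cycleFactorsFinset = {σ} := cycleFactorsFinset_eq_singleton_self_iff.2 hσ
    have hrσ : σ (r σ) ≠ r σ := by
      simpa using hr σ (by simp [hσc])
    have hrc : τ (r c) ≠ r c := mem_support.1
      (mem_cycleFactorsFinset_support_le hc (hr c (Finset.mem_union_right _ hc)))
    have hdis : Disjoint {x | σ x ≠ x} {x | τ x ≠ x} :=
      Set.disjoint_left.2 fun x h1 h2 => (hd x).elim h1 h2
    have hrσl : l (r σ) = r σ := hl.2 _ (Set.disjoint_left.1 hdis hrσ)
    refine ⟨σ * swap (r σ) (l (r c)) * l, 1 * swap (r σ) (r c) * k, ?_, ?_, ?_⟩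
    · rw [hsupp]
      exact IsSoleCycleOn.mul_swap_mul ⟨hσ.isCycleOn, fun x hx => not_not.1 hx⟩ hl hdis hrσ
        (hl.1.1.mapsTo hrc)
    · rw [hσc, Finset.coe_union, Set.image_union, Finset.coe_singleton, Set.image_singleton]
      refine IsSoleCycleOn.mul_swap_mul (isSoleCycleOn_one Set.subsingleton_singleton) hk ?_
        (Set.mem_singleton _) ⟨c, hc, rfl⟩
      rw [Set.disjoint_singleton_left]
      rintro ⟨d, hdm, hde⟩
      have := mem_cycleFactorsFinset_support_le hdm (hr d (Finset.mem_union_right _ hdm))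
      rw [hde, mem_support] at this
      exact Set.disjoint_left.1 hdis hrσ this
    · have : swap (r σ) (l (r c)) * l = l * swap (r σ) (r c) := by
        rw [mul_swap_eq_swap_mul, hrσl]
      rw [mul_assoc σ, this, one_mul, ← hlk]
      simp only [mul_assoc, swap_mul_self_mul]

theorem mem_cycleFactorsFinset_inv_iff {π c : Perm α} :
    c ∈ π⁻¹.cycleFactorsFinset ↔ c⁻¹ ∈ π.cycleFactorsFinset := by
  have aux : ∀ ρ d : Perm α, d ∈ ρ.cycleFactorsFinset → d⁻¹ ∈ ρ⁻¹.cycleFactorsFinset := by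
    intro ρ d hd
    rw [mem_cycleFactorsFinset_iff] at hd ⊢
    refine ⟨hd.1.inv, fun a ha => ?_⟩
    rw [support_inv] at ha
    have hb : d⁻¹ a ∈ d.support := by
      rwa [← apply_mem_support, ← Perm.mul_apply, mul_inv_cancel, Perm.one_apply]
    rw [Perm.eq_inv_iff_eq, ← hd.2 _ hb, ← Perm.mul_apply, mul_inv_cancel,
      Perm.one_apply]
  exact ⟨fun h => by simpa using aux _ _ h, fun h => by simpa using aux _ _ h⟩

/-- The variant of `exists_isSoleCycleOn_mul_eq` with the factors in the opposite order. -/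
theorem exists_isSoleCycleOn_mul_eq' (π : Perm α) (r : Perm α → α)
    (hr : ∀ c ∈ π.cycleFactorsFinset, r c ∈ c.support) :
    ∃ k l : Perm α, IsSoleCycleOn k (r '' π.cycleFactorsFinset) ∧
      IsSoleCycleOn l {x | π x ≠ x} ∧ k * l = π := by
  obtain ⟨l, k, hl, hk, h⟩ := exists_isSoleCycleOn_mul_eq π⁻¹ (fun c => r c⁻¹) fun c hc => by
    simpa using hr _ (mem_cycleFactorsFinset_inv_iff.1 hc)
  refine ⟨k⁻¹, l⁻¹, ?_, ?_, ?_⟩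
  · convert hk.inv using 1
    ext x
    simp only [Set.mem_image, Finset.mem_coe, mem_cycleFactorsFinset_inv_iff]
    exact ⟨fun ⟨c, hc, e⟩ => ⟨c⁻¹, by simpa using hc, by simpa using e⟩,
      fun ⟨c, hc, e⟩ => ⟨c⁻¹, hc, e⟩⟩
  · convert hl.inv using 1
    ext x
    exact not_congr (eq_comm.trans Perm.inv_eq_iff_eq.symm)
  · rw [← mul_inv_rev, h, inv_inv]

/-- Representatives of the cycles of two disjoint permutations can be chosen with distinct
`p`-values, with two of the representatives prescribed. -/
theorem exists_injOn_cycleFactorsFinset {β : Type*} [DecidableEq β] {p : α → β} {f g : Perm α}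
    (hd : Equiv.Perm.Disjoint f g) (hf : Set.InjOn p {z | f z ≠ z})
    (hg : Set.InjOn p {z | g z ≠ z})
    {x y : α} (hx : f x ≠ x) (hy : g y ≠ y) (hxy : p (f x) = p y) :
    ∃ r : Perm α → α, (∀ c ∈ (f * g).cycleFactorsFinset, r c ∈ c.support) ∧
      Set.InjOn (p ∘ r) (f * g).cycleFactorsFinset ∧
      r (f.cycleOf x) = x ∧ r (g.cycleOf y) = y := by
  set C := f.cycleOf x
  set D := g.cycleOf y
  have hun := hd.cycleFactorsFinset_mul_eq_union
  have hCf : C ∈ f.cycleFactorsFinset :=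
    cycleOf_mem_cycleFactorsFinset_iff.2 (mem_support.2 hx)
  have hDg : D ∈ g.cycleFactorsFinset :=
    cycleOf_mem_cycleFactorsFinset_iff.2 (mem_support.2 hy)
  have hCD : C ≠ D := fun e =>
    Finset.disjoint_left.1 hd.disjoint_cycleFactorsFinset hCf (e ▸ hDg)
  have hCm : C ∈ (f * g).cycleFactorsFinset := hun ▸ Finset.mem_union_left _ hCf
  have hDm : D ∈ (f * g).cycleFactorsFinset := hun ▸ Finset.mem_union_right _ hDg
  have hxC : x ∈ C.support := mem_support_cycleOf_iff.2 ⟨SameCycle.refl _ _, mem_support.2 hx⟩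
  have hyD : y ∈ D.support := mem_support_cycleOf_iff.2 ⟨SameCycle.refl _ _, mem_support.2 hy⟩
  have hfxC : f x ∈ C.support := mem_support_cycleOf_iff.2
    ⟨sameCycle_apply_right.2 (SameCycle.refl _ _), mem_support.2 hx⟩
  have huniq : ∀ z, ∀ c ∈ (f * g).cycleFactorsFinset, ∀ d ∈ (f * g).cycleFactorsFinset,
      z ∈ c.support → z ∈ d.support → c = d := fun z c hc d hd hzc hzd =>
    (cycle_is_cycleOf hzc hc).trans (cycle_is_cycleOf hzd hd).symm
  have hsupp : ∀ z, ∀ c ∈ (f * g).cycleFactorsFinset, z ∈ c.support → f z ≠ z ∨ g z ≠ z := by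
    intro z c hc hz
    have := mem_cycleFactorsFinset_support_le hc hz
    rw [hd.support_mul] at this
    simpa using this
  have hclass : ∀ c ∈ (f * g).cycleFactorsFinset, c ≠ C → c ≠ D → ∀ z ∈ c.support,
      p z ≠ p y ∧ (p z = p x → g z ≠ z) := by
    intro c hc hcC hcD z hz
    refine ⟨fun h => ?_, fun h => ?_⟩
    · rcases hsupp z c hc hz with hz' | hz'
      · have : z = f x := hf hz' (fun e => hx (f.injective e)) (h.trans hxy.symm)
        exact hcC (huniq z c hc C hCm hz (this ▸ hfxC))
      · have : z = y := hg hz' hy h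
        exact hcD (huniq z c hc D hDm hz (this ▸ hyD))
    · refine (hsupp z c hc hz).resolve_left fun hz' => ?_
      have : z = x := hf hz' hx h
      exact hcC (huniq z c hc C hCm hz (this ▸ hxC))
  have hall : ∀ s : Finset {c // c ∈ (f * g).cycleFactorsFinset ∧ c ≠ C ∧ c ≠ D},
      s.card ≤ (s.biUnion fun c => (c.1.support.filter fun z => p z ≠ p x).image p).card := by
    intro s
    set T := s.biUnion fun c => c.1.support with hT
    have hTs : ∀ z ∈ T, ∃ c ∈ (f * g).cycleFactorsFinset, c ≠ C ∧ c ≠ D ∧ z ∈ c.support := by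
      intro z hz
      obtain ⟨c, -, hz⟩ := Finset.mem_biUnion.1 hz
      exact ⟨c.1, c.2.1, c.2.2.1, c.2.2.2, hz⟩
    have hcard : s.card * 2 ≤ T.card := by
      rw [hT, Finset.card_biUnion]
      · exact Finset.card_nsmul_le_sum _ _ _ fun c _ =>
          (mem_cycleFactorsFinset_iff.1 c.2.1).1.two_le_card_support
      · intro c _ d _ hcd
        exact Finset.disjoint_left.2 fun z hzc hzd =>
          hcd (Subtype.ext (huniq z _ c.2.1 _ d.2.1 hzc hzd))
    have hone : (T.filter fun z => p z = p x).card ≤ 1 := by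
      refine Finset.card_le_one.2 fun z hz w hw => ?_
      rw [Finset.mem_filter] at hz hw
      obtain ⟨c, hc, hcC, hcD, hzc⟩ := hTs z hz.1
      obtain ⟨d, hd, hdC, hdD, hwd⟩ := hTs w hw.1
      exact hg ((hclass c hc hcC hcD z hzc).2 hz.2) ((hclass d hd hdC hdD w hwd).2 hw.2)
        (hz.2.trans hw.2.symm)
    have hsplit := Finset.card_filter_add_card_filter_not (s := T) (fun z => p z = p x)
    have himg := Finset.card_le_mul_card_image (f := p) (T.filter fun z => ¬ p z = p x) 2
      fun b _ => by
        refine le_trans (Finset.card_le_card (t :=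
          ((Finset.univ.filter fun z => f z ≠ z ∧ p z = b) ∪
            Finset.univ.filter fun z => g z ≠ z ∧ p z = b)) ?_) ?_
        · intro z hz
          simp only [Finset.mem_filter] at hz
          obtain ⟨c, hc, -, -, hzc⟩ := hTs z hz.1.1
          simpa [hz.2] using hsupp z c hc hzc
        · refine (Finset.card_union_le _ _).trans (Nat.add_le_add (b := 1) (d := 1) ?_ ?_) <;>
            refine Finset.card_le_one.2 fun z hz w hw => ?_ <;>
            simp only [Finset.mem_filter, Finset.mem_univ, true_and] at hz hw
          · exact hf hz.1 hw.1 (hz.2.trans hw.2.symm)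
          · exact hg hz.1 hw.1 (hz.2.trans hw.2.symm)
    have heq : (T.filter fun z => ¬ p z = p x).image p =
        s.biUnion fun c => (c.1.support.filter fun z => p z ≠ p x).image p := by
      rw [hT, Finset.filter_biUnion, Finset.biUnion_image]
    rw [heq] at himg
    omega
  obtain ⟨φ, hφinj, hφ⟩ := (Finset.all_card_le_biUnion_card_iff_exists_injective _).1 hall
  have hφ' : ∀ c, ∃ z ∈ c.1.support, p z ≠ p x ∧ p z = φ c := by
    intro c
    obtain ⟨z, hz, e⟩ := Finset.mem_image.1 (hφ c)
    rw [Finset.mem_filter] at hz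
    exact ⟨z, hz.1, hz.2, e⟩
  choose ψ hψs hψx hψ using hφ'
  have hpxy : p y ≠ p x := fun e => hx (hf (fun h => hx (f.injective h)) hx (hxy.trans e))
  refine ⟨fun c => if h : c ∈ (f * g).cycleFactorsFinset ∧ c ≠ C ∧ c ≠ D then ψ ⟨c, h⟩ else
    if c = C then x else y, ?_, ?_, ?_, ?_⟩
  · intro c hc
    by_cases h1 : c = C
    · simpa [h1] using hxC
    by_cases h2 : c = D
    · simpa [h2, hCD.symm] using hyD
    simpa [hc, h1, h2] using hψs ⟨c, hc, h1, h2⟩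
  · have hψy : ∀ c, p (ψ c) ≠ p y := fun c =>
      (hclass c.1 c.2.1 c.2.2.1 c.2.2.2 _ (hψs c)).1
    have hψinj : ∀ c d, p (ψ c) = p (ψ d) → c = d := fun c d e =>
      hφinj (by rw [← hψ, ← hψ, e])
    intro c hc d hd e
    rw [Finset.mem_coe] at hc hd
    simp only [Function.comp_apply, hc, hd, true_and] at e
    grind
  · simp
  · simp [hCD.symm]

theorem IsSoleCycleOn.isPCycle {m n : ℕ} {p : Fin m → Fin n} {f : Perm (Fin m)}
    {s : Set (Fin m)} (h : IsSoleCycleOn f s) (hs : Set.InjOn p s) : IsPCycle p f :=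
  ⟨hs.mono fun x hx => by
    by_contra hxs
    exact hx (h.2 x hxs), h.eq_one_or_isCycle⟩

/-- The product of two `p`-balanced permutations with disjoint supports equals
(after composing with `p`) a product of three `p`-cycles with the same support. -/
theorem two_balanced_perms_three_pCycles
    (m n : ℕ) (p : Fin m → Fin n) (π₁ π₂ : Equiv.Perm (Fin m))
    (h₁ : IsBalanced p π₁) (h₂ : IsBalanced p π₂)
    (hdisj : Disjoint (psupp π₁) (psupp π₂)) :
    ∃ σ₁ σ₂ σ₃ : Equiv.Perm (Fin m),
      IsPCycle p σ₁ ∧ IsPCycle p σ₂ ∧ IsPCycle p σ₃ ∧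
      psupp (σ₃ * σ₂ * σ₁) = psupp (π₂ * π₁) ∧
      p ∘ ⇑(σ₃ * σ₂ * σ₁) = p ∘ ⇑(π₂ * π₁) := by
  have hd : Equiv.Perm.Disjoint π₁ π₂ := fun x => by
    by_contra! h
    exact Set.disjoint_left.1 hdisj h.1 h.2
  have hsupp : ∀ z, z ∈ psupp (π₂ * π₁) ↔ π₁ z ≠ z ∨ π₂ z ≠ z := by
    intro z
    have := congrArg (z ∈ ·) hd.symm.support_mul
    simpa only [psupp, Set.mem_ofPred_eq, Finset.mem_union, mem_support, eq_iff_iff, or_comm]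
      using this
  by_cases hdouble : ∃ a y, π₁ a ≠ a ∧ π₂ y ≠ y ∧ p a = p y
  · obtain ⟨a, y, ha, hy, hay⟩ := hdouble
    obtain ⟨x, rfl⟩ := π₁.surjective a
    have hx : π₁ x ≠ x := fun h => ha (congrArg π₁ h)
    obtain ⟨r, hr, hinj, hrx, hry⟩ := exists_injOn_cycleFactorsFinset hd h₁ h₂ hx hy hay
    rw [hd.cycleFactorsFinset_mul_eq_union] at hr hinj
    rw [Finset.coe_union] at hinj
    obtain ⟨l₁, k₁, hl₁, hk₁, e₁⟩ := exists_isSoleCycleOn_mul_eq π₁ r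
      fun c hc => hr c (Finset.mem_union_left _ hc)
    obtain ⟨k₂, l₂, hk₂, hl₂, e₂⟩ := exists_isSoleCycleOn_mul_eq' π₂ r
      fun c hc => hr c (Finset.mem_union_right _ hc)
    have hdis : Disjoint (r '' π₁.cycleFactorsFinset) (r '' π₂.cycleFactorsFinset) := by
      rw [Set.disjoint_left]
      rintro _ ⟨c, hc, rfl⟩ ⟨d, hdm, hde⟩
      have : d = c := hinj (Or.inr hdm) (Or.inl hc) (congrArg p hde)
      exact Finset.disjoint_left.1 hd.disjoint_cycleFactorsFinset hc (this ▸ hdm)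
    have hk := hk₁.mul_swap_mul hk₂ hdis
      ⟨_, cycleOf_mem_cycleFactorsFinset_iff.2 (mem_support.2 hx), hrx⟩
      ⟨_, cycleOf_mem_cycleFactorsFinset_iff.2 (mem_support.2 hy), hry⟩
    have hπ₁y : π₁ y = y := (hd y).resolve_right hy
    have heq : l₁ * (k₁ * swap x y * k₂) * l₂ = swap (π₁ x) y * (π₂ * π₁) := by
      calc l₁ * (k₁ * swap x y * k₂) * l₂ = (l₁ * k₁) * swap x y * (k₂ * l₂) := by
            simp only [mul_assoc]
        _ = swap (π₁ x) y * (π₂ * π₁) := by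
            rw [e₁, e₂, mul_swap_eq_swap_mul, hπ₁y, mul_assoc, hd.commute.eq]
    have hp : ∀ z, p (swap (π₁ x) y z) = p z := by
      intro z
      rw [swap_apply_def]
      split_ifs with h h' <;> simp_all
    refine ⟨l₂, k₁ * swap x y * k₂, l₁, hl₂.isPCycle h₂, hk.isPCycle ?_, hl₁.isPCycle h₁, ?_, ?_⟩
    · rw [← Set.image_union]
      exact hinj.image_of_comp
    · rw [heq]
      ext z
      by_cases hz : z ∈ psupp (π₂ * π₁)
      · refine iff_of_true (fun h => ?_) hz
        have hpz : p ((π₂ * π₁) z) = p z := by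
          rw [← hp, ← Perm.mul_apply, h]
        rcases (hsupp z).1 hz with h1 | h2
        · have h2 : π₂ (π₁ z) = π₁ z := (hd _).resolve_left fun h => h1 (π₁.injective h)
          rw [Perm.mul_apply, h2] at hpz
          exact h1 (h₁ (fun h => h1 (π₁.injective h)) h1 hpz)
        · have h1 : π₁ z = z := (hd _).resolve_right h2
          rw [Perm.mul_apply, h1] at hpz
          exact h2 (h₂ (fun h => h2 (π₂.injective h)) h2 hpz)
      · refine iff_of_false (not_not.2 ?_) hz
        have hzf : (π₂ * π₁) z = z := not_not.1 hz
        rw [hsupp] at hz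
        rw [Perm.mul_apply, hzf]
        exact swap_apply_of_ne_of_ne (fun h => hz (Or.inl (h ▸ ha))) fun h => hz (Or.inr (h ▸ hy))
    · rw [heq]
      funext z
      exact hp _
  · push Not at hdouble
    have hinj : Set.InjOn p (psupp (π₂ * π₁)) := by
      intro z hz w hw e
      rcases (hsupp z).1 hz with hz | hz <;> rcases (hsupp w).1 hw with hw | hw
      · exact h₁ hz hw e
      · exact absurd e (hdouble z w hz hw)
      · exact absurd e.symm (hdouble w z hw hz)
      · exact h₂ hz hw e
    rcases isEmpty_or_nonempty (Fin m) with _ | _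
    · have hone : IsPCycle p 1 :=
        (isSoleCycleOn_one Set.subsingleton_empty).isPCycle (Set.injOn_empty p)
      exact ⟨1, 1, 1, hone, hone, hone, Subsingleton.elim _ _, Subsingleton.elim _ _⟩
    have hrep : ∀ c ∈ (π₂ * π₁).cycleFactorsFinset, ∃ z, z ∈ c.support := fun c hc =>
      (mem_cycleFactorsFinset_iff.1 hc).1.nonempty_support
    choose! r hr using hrep
    obtain ⟨l, k, hl, hk, e⟩ := exists_isSoleCycleOn_mul_eq (π₂ * π₁) r hr
    refine ⟨1, k, l, (isSoleCycleOn_one Set.subsingleton_empty).isPCycle (Set.injOn_empty p),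
      hk.isPCycle (hinj.mono ?_), hl.isPCycle hinj, ?_, ?_⟩
    · rintro _ ⟨c, hc, rfl⟩
      exact mem_support.1 (mem_cycleFactorsFinset_support_le hc (hr c hc))
    · rw [mul_one, e]
    · rw [mul_one, e]
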